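/- The generalized Petersen graph GP(10,2) viewed as the underlying structure: there exists a triangle-free graph on 20 vertices with maximum degree 5 and independence number 6, hence i(5) ≤ 3/10. -/

import Mathlib

/-- `s` is an independent set of `G`: pairwise non-adjacent vertices. -/
def IsIndepSet {V : Type*} (G : SimpleGraph V) (s : Set V) : Prop :=
  s.Pairwise fun a b => ¬ G.Adj a b

/-- The independence number of a graph on a finite vertex type. -/
noncomputable def indepNum {V : Type*} (G : SimpleGraph V) : ℕ :=
  sSup {k | ∃ s : Finset V, IsIndepSet G ↑s ∧ s.card = k}

/-- The largest number of vertices of `l` that can be chosen pairwise non-adjacent and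
non-adjacent to all vertices of `c`, found by deciding the vertices of `l` one at a time. -/
def maxIndepExtension {V : Type*} (G : SimpleGraph V) [DecidableRel G.Adj] :
    List V → List V → ℕ
  | _, [] => 0
  | c, v :: l =>
    if ∃ u ∈ c, G.Adj u v then maxIndepExtension G c l
    else max (maxIndepExtension G c l) (maxIndepExtension G (v :: c) l + 1)

theorem IsIndepSet.card_le_maxIndepExtension {V : Type*} [DecidableEq V] {G : SimpleGraph V}
    [DecidableRel G.Adj] {s : Finset V} {c l : List V} (hs : IsIndepSet G (s : Set V))
    (hl : ∀ w ∈ s, w ∈ l) (hc : ∀ u ∈ c, ∀ w ∈ s, ¬ G.Adj u w) :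
    s.card ≤ maxIndepExtension G c l := by
  induction l generalizing c s with
  | nil => simp [Finset.eq_empty_of_forall_notMem fun w hw => by simpa using hl w hw]
  | cons v l ih =>
    by_cases hv : v ∈ s
    · have key : (s.erase v).card ≤ maxIndepExtension G (v :: c) l := by
        refine ih (hs.mono (by simp)) (fun w hw => ?_) (fun u hu w hw => ?_)
        · have := hl w (Finset.mem_of_mem_erase hw)
          simpa [Finset.ne_of_mem_erase hw] using this
        · rcases List.mem_cons.1 hu with rfl | hu
          · exact hs hv (Finset.mem_of_mem_erase hw) (Finset.ne_of_mem_erase hw).symm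
          · exact hc u hu w (Finset.mem_of_mem_erase hw)
      have hcard := Finset.card_erase_add_one hv
      have hn : ¬ ∃ u ∈ c, G.Adj u v := fun ⟨u, hu, h⟩ => hc u hu v hv h
      rw [maxIndepExtension, if_neg hn]
      exact le_max_of_le_right (by omega)
    · have key : s.card ≤ maxIndepExtension G c l := by
        refine ih hs (fun w hw => ?_) hc
        rcases List.mem_cons.1 (hl w hw) with rfl | h
        · exact absurd hw hv
        · exact h
      rw [maxIndepExtension]
      split_ifs
      · exact key
      · exact le_max_of_le_left key

/-- The circulant graph on `ℤ/20` with connection set `{±1, ±6, 10}`. -/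
abbrev circulantTwenty : SimpleGraph (Fin 20) where
  Adj a b := b - a ∈ ([1, 19, 6, 14, 10] : List (Fin 20))
  symm := ⟨by decide +kernel⟩
  loopless := ⟨by decide +kernel⟩

instance : DecidableRel circulantTwenty.Adj :=
  fun a b => inferInstanceAs (Decidable (b - a ∈ ([1, 19, 6, 14, 10] : List (Fin 20))))

theorem circulantTwenty_cliqueFree : circulantTwenty.CliqueFree 3 := by
  intro s hs
  obtain ⟨a, b, c, hab, hac, hbc, -⟩ := SimpleGraph.is3Clique_iff.1 hs
  have h : ∀ a b c : Fin 20, circulantTwenty.Adj a b → circulantTwenty.Adj a c →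
      ¬ circulantTwenty.Adj b c := by decide +kernel
  exact h a b c hab hac hbc

theorem circulantTwenty_ncard_neighborSet (v : Fin 20) :
    (circulantTwenty.neighborSet v).ncard = 5 := by
  rw [Set.ncard_eq_toFinset_card']
  revert v
  decide +kernel

theorem circulantTwenty_card_le {s : Finset (Fin 20)}
    (hs : IsIndepSet circulantTwenty (s : Set (Fin 20))) : s.card ≤ 6 := by
  have h : maxIndepExtension circulantTwenty [] (List.finRange 20) = 6 := by decide +kernel
  exact h ▸ hs.card_le_maxIndepExtension (fun w _ => List.mem_finRange w) (by simp)

theorem indepNum_circulantTwenty : indepNum circulantTwenty = 6 := by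
  refine IsGreatest.csSup_eq ⟨⟨{0, 2, 4, 7, 9, 11}, ?_, rfl⟩, ?_⟩
  · intro a ha b hb _
    have h : ∀ a ∈ ({0, 2, 4, 7, 9, 11} : Finset (Fin 20)), ∀ b ∈ ({0, 2, 4, 7, 9, 11} : Finset (Fin 20)),
        ¬ circulantTwenty.Adj a b := by decide +kernel
    exact h a ha b hb
  · rintro k ⟨s, hs, rfl⟩
    exact circulantTwenty_card_le hs


/-- There is a triangle-free graph on 20 vertices with maximum degree 5 and independence
number exactly 6 (e.g. the circulant graph on ℤ/20 with connection set {±1, ±6, 10});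
hence the minimum independence ratio `i(5)` over triangle-free graphs of maximum degree
at most 5 satisfies `i(5) ≤ 6/20 = 3/10`. -/
theorem i5_le_three_tenths :
    (∃ G : SimpleGraph (Fin 20),
      G.CliqueFree 3 ∧
      (∀ v, (G.neighborSet v).ncard ≤ 5) ∧ (∃ v, (G.neighborSet v).ncard = 5) ∧
      indepNum G = 6) ∧
    sInf {r : ℝ | ∃ (n : ℕ) (G : SimpleGraph (Fin n)), 0 < n ∧
        G.CliqueFree 3 ∧ (∀ v, (G.neighborSet v).ncard ≤ 5) ∧
        r = (indepNum G : ℝ) / n} ≤ 3 / 10 := by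
  refine ⟨⟨circulantTwenty, circulantTwenty_cliqueFree,
    fun v => (circulantTwenty_ncard_neighborSet v).le,
    ⟨0, circulantTwenty_ncard_neighborSet 0⟩, indepNum_circulantTwenty⟩, csInf_le ⟨0, ?_⟩ ?_⟩
  · rintro r ⟨n, G, -, -, -, rfl⟩
    positivity
  · refine ⟨20, circulantTwenty, by norm_num, circulantTwenty_cliqueFree,
      fun v => (circulantTwenty_ncard_neighborSet v).le, ?_⟩
    rw [indepNum_circulantTwenty]
    norm_num
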